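/- arXiv:1508.05574 — 3 statements merged into one kernel-verified Lean document; each statement's English description precedes it below -/
import Mathlib

section
/- Let (A, λ) be a finitely additive measure structure on Ω and X : Ω → ℝ with X ≥ 0. Then X ∈ L¹(λ) if and only if ∫₀^∞ λ_*(X > t) dt = ∫₀^∞ λ*(X > t) dt < ∞, and in that case the layer-cake formula holds: ∫ X dλ = ∫₀^∞ λ_*(X > t) dt. -/
open scoped ENNReal
open MeasureTheory Filter

namespace FA

variable {Ω : Type*}

/-- Outer measure induced by a finitely additive set function on a ring. -/
noncomputable def outer (𝒜 : Set (Set Ω)) (l : Set Ω → ℝ) (E : Set Ω) : ℝ≥0∞ :=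
  ⨅ (A : Set Ω) (_ : A ∈ 𝒜) (_ : E ⊆ A), ENNReal.ofReal (l A)

/-- Inner measure induced by a finitely additive set function on a ring. -/
noncomputable def inner (𝒜 : Set (Set Ω)) (l : Set Ω → ℝ) (E : Set Ω) : ℝ≥0∞ :=
  ⨆ (B : Set Ω) (_ : B ∈ 𝒜) (_ : B ⊆ E), ENNReal.ofReal (l B)

/-- `f` is an `𝒜`-simple function. -/
def IsSimple (𝒜 : Set (Set Ω)) (f : Ω → ℝ) : Prop :=
  ∃ (s : Finset (Set Ω)) (c : Set Ω → ℝ), (∀ A ∈ s, A ∈ 𝒜) ∧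
    ∀ ω, f ω = ∑ A ∈ s, c A * (A.indicator (fun _ => (1 : ℝ)) ω)

/-- `I` is the elementary integral of the `𝒜`-simple function `f` with respect to `l`. -/
def SimpleIntegralEq (𝒜 : Set (Set Ω)) (l : Set Ω → ℝ) (f : Ω → ℝ) (I : ℝ) : Prop :=
  ∃ (s : Finset (Set Ω)) (c : Set Ω → ℝ), (∀ A ∈ s, A ∈ 𝒜) ∧
    (∀ ω, f ω = ∑ A ∈ s, c A * (A.indicator (fun _ => (1 : ℝ)) ω)) ∧
    I = ∑ A ∈ s, c A * l A

/-- `f n` converges to `g` in `l`-measure. -/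
def ConvInMeasure (𝒜 : Set (Set Ω)) (l : Set Ω → ℝ) (f : ℕ → Ω → ℝ) (g : Ω → ℝ) : Prop :=
  ∀ c : ℝ, 0 < c →
    Tendsto (fun n => outer 𝒜 l {ω | c < |f n ω - g ω|}) atTop (nhds 0)

/-- The sequence `f` is Cauchy in the `L¹(l)` seminorm. -/
def CauchyL1 (𝒜 : Set (Set Ω)) (l : Set Ω → ℝ) (f : ℕ → Ω → ℝ) : Prop :=
  ∀ ε : ℝ, 0 < ε → ∃ N : ℕ, ∀ m ≥ N, ∀ n ≥ N,
    ∃ I : ℝ, SimpleIntegralEq 𝒜 l (fun ω => |f m ω - f n ω|) I ∧ I < ε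

/-- `f` is integrable in the finitely additive (Dunford–Schwartz) sense with integral `I`. -/
def HasIntegral (𝒜 : Set (Set Ω)) (l : Set Ω → ℝ) (f : Ω → ℝ) (I : ℝ) : Prop :=
  ∃ (g : ℕ → Ω → ℝ) (J : ℕ → ℝ), (∀ n, IsSimple 𝒜 (g n)) ∧
    ConvInMeasure 𝒜 l g f ∧ CauchyL1 𝒜 l g ∧
    (∀ n, SimpleIntegralEq 𝒜 l (g n) (J n)) ∧ Tendsto J atTop (nhds I)

/-- `f ∈ L¹(l)`. -/
def MemL1 (𝒜 : Set (Set Ω)) (l : Set Ω → ℝ) (f : Ω → ℝ) : Prop :=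
  ∃ I : ℝ, HasIntegral 𝒜 l f I

/-- `f` is `l`-measurable: an `l`-limit in measure of `𝒜`-simple functions. -/
def FAMeasurable (𝒜 : Set (Set Ω)) (l : Set Ω → ℝ) (f : Ω → ℝ) : Prop :=
  ∃ g : ℕ → Ω → ℝ, (∀ n, IsSimple 𝒜 (g n)) ∧ ConvInMeasure 𝒜 l g f

/-- `(𝒜, l)` is a finitely additive measure structure on `Ω`. -/
def FAMeasure (𝒜 : Set (Set Ω)) (l : Set Ω → ℝ) : Prop :=
  MeasureTheory.IsSetRing 𝒜 ∧ (∀ A ∈ 𝒜, 0 ≤ l A) ∧ l ∅ = 0 ∧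
    ∀ A ∈ 𝒜, ∀ B ∈ 𝒜, Disjoint A B → l (A ∪ B) = l A + l B

/-- The ring `𝒜(l)` of sets whose inner and outer measures agree and are finite. -/
def AgreeRing (𝒜 : Set (Set Ω)) (l : Set Ω → ℝ) : Set (Set Ω) :=
  {E : Set Ω | outer 𝒜 l E = inner 𝒜 l E ∧ outer 𝒜 l E < ⊤}

end FA

namespace FA

variable {Ω : Type*} {𝒜 : Set (Set Ω)} {l : Set Ω → ℝ} {μ : Set Ω → ℝ≥0∞}

/-- The integral of the tail function `t ↦ μ (X > t)` over `(0, ∞)`. -/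
noncomputable def layer (μ : Set Ω → ℝ≥0∞) (X : Ω → ℝ) : ℝ≥0∞ :=
  ∫⁻ t in Set.Ioi (0 : ℝ), μ {ω | t < X ω}

/-- `μ` is a monotone extension of `l` for which every member of `𝒜` is Carathéodory measurable. -/
structure IsCut (𝒜 : Set (Set Ω)) (l : Set Ω → ℝ) (μ : Set Ω → ℝ≥0∞) : Prop where
  mono : Monotone μ
  split : ∀ A ∈ 𝒜, ∀ E, μ E = μ (E ∩ A) + μ (E \ A)
  val : ∀ A ∈ 𝒜, μ A = ENNReal.ofReal (l A)

lemma FAMeasure.mono (hl : FAMeasure 𝒜 l) {A B : Set Ω} (hA : A ∈ 𝒜) (hB : B ∈ 𝒜)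
    (h : A ⊆ B) : l A ≤ l B := by
  obtain ⟨hR, h0, -, hadd⟩ := hl
  have := hadd A hA (B \ A) (hR.sdiff_mem hB hA) Set.disjoint_sdiff_right
  rw [Set.union_sdiff_cancel h] at this
  linarith [h0 _ (hR.sdiff_mem hB hA)]

lemma FAMeasure.split (hl : FAMeasure 𝒜 l) {A B : Set Ω} (hA : A ∈ 𝒜) (hB : B ∈ 𝒜) :
    l B = l (B ∩ A) + l (B \ A) := by
  obtain ⟨hR, -, -, hadd⟩ := hl
  rw [← hadd _ (hR.inter_mem hB hA) _ (hR.sdiff_mem hB hA)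
    (Set.disjoint_sdiff_right.mono_left Set.inter_subset_right), Set.inter_union_sdiff]

lemma FAMeasure.union_le (hl : FAMeasure 𝒜 l) {A B : Set Ω} (hA : A ∈ 𝒜) (hB : B ∈ 𝒜) :
    l (A ∪ B) ≤ l A + l B := by
  have h := hl.split hA (hl.1.union_mem hA hB)
  rw [Set.union_inter_cancel_left, Set.union_sdiff_left] at h
  linarith [hl.mono (hl.1.sdiff_mem hB hA) hB Set.sdiff_subset]

lemma outer_le {A E : Set Ω} (hA : A ∈ 𝒜) (h : E ⊆ A) : outer 𝒜 l E ≤ ENNReal.ofReal (l A) :=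
  iInf_le_of_le A (iInf_le_of_le hA (iInf_le_of_le h le_rfl))

lemma le_inner {B E : Set Ω} (hB : B ∈ 𝒜) (h : B ⊆ E) : ENNReal.ofReal (l B) ≤ inner 𝒜 l E :=
  le_iSup_of_le B (le_iSup_of_le hB (le_iSup_of_le h le_rfl))

lemma outer_mono : Monotone (outer 𝒜 l) := fun _ _ h =>
  le_iInf fun _ => le_iInf fun hA => le_iInf fun hF => outer_le hA (h.trans hF)

lemma inner_mono : Monotone (inner 𝒜 l) := fun _ _ h =>
  iSup_le fun _ => iSup_le fun hB => iSup_le fun hE => le_inner hB (hE.trans h)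

lemma inner_le_outer (hl : FAMeasure 𝒜 l) (E : Set Ω) : inner 𝒜 l E ≤ outer 𝒜 l E :=
  iSup_le fun _ => iSup_le fun hB => iSup_le fun hBE => le_iInf fun _ => le_iInf fun hA =>
    le_iInf fun hEA => ENNReal.ofReal_le_ofReal (hl.mono hB hA (hBE.trans hEA))

lemma outer_le_add (hl : FAMeasure 𝒜 l) {E F G : Set Ω} (h : E ⊆ F ∪ G) :
    outer 𝒜 l E ≤ outer 𝒜 l F + outer 𝒜 l G := by
  rw [← tsub_le_iff_right]
  refine le_iInf fun A => le_iInf fun hA => le_iInf fun hFA => ?_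
  rw [tsub_le_iff_right, add_comm, ← tsub_le_iff_right]
  refine le_iInf fun B => le_iInf fun hB => le_iInf fun hGB => ?_
  rw [tsub_le_iff_right, add_comm, ← ENNReal.ofReal_add (hl.2.1 _ hA) (hl.2.1 _ hB)]
  exact (outer_le (hl.1.union_mem hA hB) (h.trans (Set.union_subset_union hFA hGB))).trans
    (ENNReal.ofReal_le_ofReal (hl.union_le hA hB))

lemma inner_le_add (hl : FAMeasure 𝒜 l) {E F G : Set Ω} (h : E ⊆ F ∪ G) :
    inner 𝒜 l E ≤ inner 𝒜 l F + outer 𝒜 l G := by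
  refine iSup_le fun B => iSup_le fun hB => iSup_le fun hBE => ?_
  rw [add_comm, ← tsub_le_iff_right]
  refine le_iInf fun A => le_iInf fun hA => le_iInf fun hGA => ?_
  rw [tsub_le_iff_right]
  have hsub : B \ A ⊆ F := fun ω hω =>
    (h (hBE hω.1)).resolve_right fun hG => hω.2 (hGA hG)
  refine le_trans ?_ (add_le_add_right (le_inner (hl.1.sdiff_mem hB hA) hsub) _)
  rw [hl.split hA hB]
  refine ENNReal.ofReal_add_le.trans (add_le_add_left (ENNReal.ofReal_le_ofReal ?_) _)
  exact hl.mono (hl.1.inter_mem hB hA) hA Set.inter_subset_right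

lemma isCut_outer (hl : FAMeasure 𝒜 l) : IsCut 𝒜 l (outer 𝒜 l) where
  mono := outer_mono
  split A hA E := by
    refine le_antisymm (outer_le_add hl (Set.inter_union_sdiff E A).ge) ?_
    refine le_iInf fun D => le_iInf fun hD => le_iInf fun hED => ?_
    rw [hl.split hA hD, ENNReal.ofReal_add (hl.2.1 _ (hl.1.inter_mem hD hA))
      (hl.2.1 _ (hl.1.sdiff_mem hD hA))]
    exact add_le_add (outer_le (hl.1.inter_mem hD hA) (Set.inter_subset_inter_left _ hED))
      (outer_le (hl.1.sdiff_mem hD hA) (Set.sdiff_subset_sdiff_left hED))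
  val A hA := le_antisymm (outer_le hA subset_rfl) <|
    le_iInf fun _ => le_iInf fun hD => le_iInf fun hAD =>
      ENNReal.ofReal_le_ofReal (hl.mono hA hD hAD)

lemma isCut_inner (hl : FAMeasure 𝒜 l) : IsCut 𝒜 l (inner 𝒜 l) where
  mono := inner_mono
  split A hA E := by
    refine le_antisymm ?_ ?_
    · refine iSup_le fun D => iSup_le fun hD => iSup_le fun hED => ?_
      rw [hl.split hA hD, ENNReal.ofReal_add (hl.2.1 _ (hl.1.inter_mem hD hA))
        (hl.2.1 _ (hl.1.sdiff_mem hD hA))]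
      exact add_le_add (le_inner (hl.1.inter_mem hD hA) (Set.inter_subset_inter_left _ hED))
        (le_inner (hl.1.sdiff_mem hD hA) (Set.sdiff_subset_sdiff_left hED))
    · have key : ∀ B ∈ 𝒜, B ⊆ E ∩ A → ∀ C ∈ 𝒜, C ⊆ E \ A →
          ENNReal.ofReal (l B) + ENNReal.ofReal (l C) ≤ inner 𝒜 l E := by
        intro B hB hBE C hC hCE
        rw [← ENNReal.ofReal_add (hl.2.1 _ hB) (hl.2.1 _ hC), ← hl.2.2.2 B hB C hC
          (Set.disjoint_left.2 fun ω h1 h2 => (hCE h2).2 (hBE h1).2)]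
        exact le_inner (hl.1.union_mem hB hC) (Set.union_subset
          (hBE.trans Set.inter_subset_left) (hCE.trans Set.sdiff_subset))
      have h := ENNReal.biSup_add_biSup_le' (p := fun B => B ∈ 𝒜 ∧ B ⊆ E ∩ A)
        (q := fun C => C ∈ 𝒜 ∧ C ⊆ E \ A) ⟨∅, hl.1.empty_mem, Set.empty_subset _⟩
        ⟨∅, hl.1.empty_mem, Set.empty_subset _⟩
        (fun B hB C hC => key B hB.1 hB.2 C hC.1 hC.2)
      simp only [iSup_and] at h
      exact h
  val A hA := le_antisymm (iSup_le fun _ => iSup_le fun hD => iSup_le fun hAD =>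
      ENNReal.ofReal_le_ofReal (hl.mono hD hA hAD)) (le_inner hA subset_rfl)

lemma IsCut.empty (hμ : IsCut 𝒜 l μ) (hl : FAMeasure 𝒜 l) : μ ∅ = 0 := by
  rw [hμ.val _ hl.1.empty_mem, hl.2.2.1, ENNReal.ofReal_zero]

lemma antitone_tail (hμ : Monotone μ) (X : Ω → ℝ) : Antitone fun t : ℝ => μ {ω | t < X ω} :=
  fun _ _ h => hμ fun _ hω => lt_of_le_of_lt h hω

lemma setLIntegral_Ioi_comp_mul_left {a : ℝ} (ha : 0 < a) (φ : ℝ → ℝ≥0∞) :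
    ∫⁻ t in Set.Ioi (0 : ℝ), φ (a * t) = ENNReal.ofReal a⁻¹ * ∫⁻ t in Set.Ioi (0 : ℝ), φ t := by
  have he : MeasurableEmbedding fun t : ℝ => a * t :=
    (Homeomorph.mulLeft₀ a ha.ne').measurableEmbedding
  have hpre : (fun t : ℝ => a * t) ⁻¹' Set.Ioi 0 = Set.Ioi 0 := by
    ext t; simp [ha]
  have h := he.lintegral_map (μ := volume.restrict (Set.Ioi 0)) φ
  rw [← h, ← hpre, ← he.restrict_map, Real.map_volume_mul_left ha.ne', hpre,
    Measure.restrict_smul, lintegral_smul_measure, abs_of_pos (inv_pos.2 ha), smul_eq_mul]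

lemma setLIntegral_Ioi_comp_sub_right {c : ℝ} (hc : 0 ≤ c) (φ : ℝ → ℝ≥0∞) :
    ∫⁻ t in Set.Ioi (0 : ℝ), φ (t - c) =
      (∫⁻ t in Set.Ioo (-c) 0, φ t) + ∫⁻ t in Set.Ioi (0 : ℝ), φ t := by
  have h := (measurePreserving_sub_right volume c).setLIntegral_comp_preimage_emb
    (MeasurableEquiv.subRight c).measurableEmbedding φ (Set.Ioi (-c))
  have hpre : (fun t : ℝ => t - c) ⁻¹' Set.Ioi (-c) = Set.Ioi 0 := by
    ext t; simp
  rw [hpre] at h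
  rw [h, ← Set.Ioc_union_Ioi_eq_Ioi (neg_nonpos.2 hc),
    lintegral_union measurableSet_Ioi (Set.Ioc_disjoint_Ioi le_rfl),
    setLIntegral_congr Ioo_ae_eq_Ioc]

lemma layer_add_indicator (hμ : IsCut 𝒜 l μ) {A : Set Ω} (hA : A ∈ 𝒜)
    {c : ℝ} (hc : 0 ≤ c) {Y : Ω → ℝ} (hY : ∀ ω, 0 ≤ Y ω) :
    layer μ (fun ω => c * A.indicator (fun _ => 1) ω + Y ω) =
      ENNReal.ofReal (c * l A) + layer μ Y := by
  have hin : Antitone fun t : ℝ => μ ({ω | t < Y ω} ∩ A) := fun _ _ h =>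
    hμ.mono fun _ hω => ⟨lt_of_le_of_lt h hω.1, hω.2⟩
  have hout : Antitone fun t : ℝ => μ ({ω | t < Y ω} \ A) := fun _ _ h =>
    hμ.mono fun _ hω => ⟨lt_of_le_of_lt h hω.1, hω.2⟩
  have e1 : layer μ (fun ω => c * A.indicator (fun _ => 1) ω + Y ω) =
      ∫⁻ t in Set.Ioi (0 : ℝ), (μ ({ω | t - c < Y ω} ∩ A) + μ ({ω | t < Y ω} \ A)) := by
    refine lintegral_congr fun t => ?_
    rw [hμ.split A hA]
    congr 2 <;> ext ω <;> by_cases h : ω ∈ A <;> simp [h, sub_lt_iff_lt_add']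
  have e2 : layer μ Y =
      ∫⁻ t in Set.Ioi (0 : ℝ), (μ ({ω | t < Y ω} ∩ A) + μ ({ω | t < Y ω} \ A)) :=
    lintegral_congr fun t => hμ.split A hA _
  have e3 : ∫⁻ t in Set.Ioo (-c) 0, μ ({ω | t < Y ω} ∩ A) = ENNReal.ofReal (c * l A) := by
    rw [setLIntegral_congr_fun (g := fun _ => ENNReal.ofReal (l A)) measurableSet_Ioo]
    · simp [ENNReal.ofReal_mul hc, mul_comm]
    · intro t ht
      have : {ω | t < Y ω} ∩ A = A :=
        Set.inter_eq_right.2 fun ω _ => lt_of_lt_of_le ht.2 (hY ω)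
      simp only [this, hμ.val A hA]
  rw [e1, e2, lintegral_add_right _ hout.measurable, lintegral_add_right _ hout.measurable,
    setLIntegral_Ioi_comp_sub_right hc fun t => μ ({ω | t < Y ω} ∩ A), e3, add_assoc]

lemma SimpleIntegralEq.zero : SimpleIntegralEq 𝒜 l (fun _ => 0) 0 :=
  ⟨∅, 0, by simp, by simp, by simp⟩

lemma SimpleIntegralEq.smul {f : Ω → ℝ} {I : ℝ} (c : ℝ) (h : SimpleIntegralEq 𝒜 l f I) :
    SimpleIntegralEq 𝒜 l (fun ω => c * f ω) (c * I) := by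
  obtain ⟨s, a, hs, hf, rfl⟩ := h
  exact ⟨s, fun A => c * a A, hs, fun ω => by simp only [hf, Finset.mul_sum, mul_assoc],
    by simp only [Finset.mul_sum, mul_assoc]⟩

lemma SimpleIntegralEq.add {f g : Ω → ℝ} {I J : ℝ} (hf : SimpleIntegralEq 𝒜 l f I)
    (hg : SimpleIntegralEq 𝒜 l g J) : SimpleIntegralEq 𝒜 l (fun ω => f ω + g ω) (I + J) := by
  classical
  obtain ⟨s, a, hs, hf, rfl⟩ := hf
  obtain ⟨t, b, ht, hg, rfl⟩ := hg
  have key : ∀ F : Set Ω → ℝ, ∑ A ∈ s, a A * F A + ∑ A ∈ t, b A * F A =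
      ∑ A ∈ s ∪ t, ((if A ∈ s then a A else 0) + if A ∈ t then b A else 0) * F A := by
    intro F
    simp only [add_mul, ite_mul, zero_mul, Finset.sum_add_distrib, Finset.sum_ite_mem,
      Finset.union_inter_cancel_left, Finset.union_inter_cancel_right]
  refine ⟨s ∪ t, _, fun A hA => (Finset.mem_union.1 hA).elim (hs A) (ht A), fun ω => ?_, key l⟩
  simp only [hf, hg]
  exact key fun A => A.indicator (fun _ => 1) ω

lemma SimpleIntegralEq.sub {f g : Ω → ℝ} {I J : ℝ} (hf : SimpleIntegralEq 𝒜 l f I)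
    (hg : SimpleIntegralEq 𝒜 l g J) : SimpleIntegralEq 𝒜 l (fun ω => f ω - g ω) (I - J) := by
  simpa [sub_eq_add_neg] using hf.add (hg.smul (-1))

lemma SimpleIntegralEq.indicator {A : Set Ω} (hA : A ∈ 𝒜) (c : ℝ) :
    SimpleIntegralEq 𝒜 l (fun ω => c * A.indicator (fun _ => 1) ω) (c * l A) :=
  ⟨{A}, fun _ => c, by simpa using hA, by simp, by simp⟩

lemma SimpleIntegralEq.sum {ι : Type*} {s : Finset ι} {f : ι → Ω → ℝ} {I : ι → ℝ}
    (h : ∀ i ∈ s, SimpleIntegralEq 𝒜 l (f i) (I i)) :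
    SimpleIntegralEq 𝒜 l (fun ω => ∑ i ∈ s, f i ω) (∑ i ∈ s, I i) := by
  classical
  induction s using Finset.induction with
  | empty => simpa using SimpleIntegralEq.zero
  | insert i s hi ih =>
    simp only [Finset.sum_insert hi]
    exact (h i (Finset.mem_insert_self i s)).add
      (ih fun j hj => h j (Finset.mem_insert_of_mem hj))

lemma SimpleIntegralEq.isSimple {f : Ω → ℝ} {I : ℝ} (h : SimpleIntegralEq 𝒜 l f I) :
    IsSimple 𝒜 f := by
  obtain ⟨s, a, hs, hf, -⟩ := h
  exact ⟨s, a, hs, hf⟩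

lemma SimpleIntegralEq.induction {p : (Ω → ℝ) → ℝ → Prop} (zero : p (fun _ => 0) 0)
    (add : ∀ A ∈ 𝒜, ∀ (c : ℝ) (f : Ω → ℝ) (I : ℝ), p f I →
      p (fun ω => c * A.indicator (fun _ => 1) ω + f ω) (c * l A + I))
    {f : Ω → ℝ} {I : ℝ} (h : SimpleIntegralEq 𝒜 l f I) : p f I := by
  classical
  obtain ⟨s, a, hs, hf, rfl⟩ := h
  obtain rfl := funext hf
  clear hf
  induction s using Finset.induction with
  | empty => simpa using zero
  | insert A s hA ih =>
    simp only [Finset.sum_insert hA]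
    exact add A (hs A (Finset.mem_insert_self A s)) _ _ _
      (ih fun B hB => hs B (Finset.mem_insert_of_mem hB))

lemma SimpleIntegralEq.exists_indicator_mul (hl : FAMeasure 𝒜 l) {f : Ω → ℝ} {I : ℝ}
    (h : SimpleIntegralEq 𝒜 l f I) {A : Set Ω} (hA : A ∈ 𝒜) :
    ∃ J, SimpleIntegralEq 𝒜 l (fun ω => A.indicator (fun _ => 1) ω * f ω) J := by
  refine SimpleIntegralEq.induction
    (p := fun f _ => ∃ J, SimpleIntegralEq 𝒜 l (fun ω => A.indicator (fun _ => 1) ω * f ω) J)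
    ?_ ?_ h
  · exact ⟨0, by simpa using SimpleIntegralEq.zero⟩
  · rintro B hB c f I ⟨J, hJ⟩
    refine ⟨c * l (A ∩ B) + J, ?_⟩
    convert (SimpleIntegralEq.indicator (hl.1.inter_mem hA hB) c).add hJ using 2 with ω
    rw [mul_add]
    congr 1
    by_cases h1 : ω ∈ A <;> by_cases h2 : ω ∈ B <;> simp [h1, h2]

/-- Composing a simple function with a function vanishing at `0` gives a simple function. -/
lemma SimpleIntegralEq.exists_comp (hl : FAMeasure 𝒜 l) {f : Ω → ℝ} {I : ℝ}
    (h : SimpleIntegralEq 𝒜 l f I) {φ : ℝ → ℝ} (hφ : φ 0 = 0) :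
    ∃ J, SimpleIntegralEq 𝒜 l (fun ω => φ (f ω)) J := by
  refine SimpleIntegralEq.induction (p := fun f _ => ∀ φ : ℝ → ℝ, φ 0 = 0 →
    ∃ J, SimpleIntegralEq 𝒜 l (fun ω => φ (f ω)) J) ?_ ?_ h φ hφ
  · exact fun φ hφ => ⟨0, by simpa [hφ] using SimpleIntegralEq.zero⟩
  · intro A hA c f I ih φ hφ
    obtain ⟨J, hJ⟩ := ih φ hφ
    obtain ⟨K, hK⟩ := ih (fun x => φ (c + x) - φ x - φ c) (by simp [hφ])
    obtain ⟨K', hK'⟩ := hK.exists_indicator_mul hl hA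
    refine ⟨J + K' + φ c * l A, ?_⟩
    convert (hJ.add hK').add (SimpleIntegralEq.indicator hA (φ c)) using 2 with ω
    by_cases h : ω ∈ A
    · simp only [Set.indicator_of_mem h]
      ring_nf
    · simp [h]

lemma layer_const_zero (hl : FAMeasure 𝒜 l) (hμ : IsCut 𝒜 l μ) : layer μ (fun _ => 0) = 0 := by
  rw [layer, setLIntegral_congr_fun (g := fun _ => 0) measurableSet_Ioi, lintegral_zero]
  intro t ht
  simp [not_lt.2 (le_of_lt (Set.mem_Ioi.1 ht)), hμ.empty hl]

lemma layer_mono (hμ : Monotone μ) {X Y : Ω → ℝ} (h : ∀ ω, X ω ≤ Y ω) : layer μ X ≤ layer μ Y :=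
  lintegral_mono fun _ => hμ fun ω hω => lt_of_lt_of_le hω (h ω)

lemma SimpleIntegralEq.exists_sub (hl : FAMeasure 𝒜 l) (hμ : IsCut 𝒜 l μ) {f : Ω → ℝ} {I : ℝ}
    (h : SimpleIntegralEq 𝒜 l f I) :
    ∃ (p q : Ω → ℝ) (P Q : ℝ), (∀ ω, 0 ≤ p ω) ∧ (∀ ω, 0 ≤ q ω) ∧ 0 ≤ P ∧ 0 ≤ Q ∧
      (∀ ω, f ω = p ω - q ω) ∧ I = P - Q ∧
      (∀ Y : Ω → ℝ, (∀ ω, 0 ≤ Y ω) →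
        layer μ (fun ω => p ω + Y ω) = ENNReal.ofReal P + layer μ Y) ∧
      ∀ Y : Ω → ℝ, (∀ ω, 0 ≤ Y ω) →
        layer μ (fun ω => q ω + Y ω) = ENNReal.ofReal Q + layer μ Y := by
  refine SimpleIntegralEq.induction (p := fun f I =>
    ∃ (p q : Ω → ℝ) (P Q : ℝ), (∀ ω, 0 ≤ p ω) ∧ (∀ ω, 0 ≤ q ω) ∧ 0 ≤ P ∧ 0 ≤ Q ∧
      (∀ ω, f ω = p ω - q ω) ∧ I = P - Q ∧
      (∀ Y : Ω → ℝ, (∀ ω, 0 ≤ Y ω) →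
        layer μ (fun ω => p ω + Y ω) = ENNReal.ofReal P + layer μ Y) ∧
      ∀ Y : Ω → ℝ, (∀ ω, 0 ≤ Y ω) →
        layer μ (fun ω => q ω + Y ω) = ENNReal.ofReal Q + layer μ Y) ?_ ?_ h
  · exact ⟨fun _ => 0, fun _ => 0, 0, 0, by simp, by simp, le_rfl, le_rfl, by simp,
      by simp, by simp, by simp⟩
  · rintro A hA c f I ⟨p, q, P, Q, hp, hq, hP, hQ, hf, hI, hpY, hqY⟩
    have hA0 : ∀ ω, (0 : ℝ) ≤ A.indicator (fun _ => 1) ω :=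
      Set.indicator_nonneg fun _ _ => zero_le_one
    have ext_nonneg : ∀ a : ℝ, 0 ≤ a → ∀ g : Ω → ℝ, (∀ ω, 0 ≤ g ω) → ∀ G : ℝ, 0 ≤ G →
        (∀ Y : Ω → ℝ, (∀ ω, 0 ≤ Y ω) →
          layer μ (fun ω => g ω + Y ω) = ENNReal.ofReal G + layer μ Y) →
        ∀ Y : Ω → ℝ, (∀ ω, 0 ≤ Y ω) →
          layer μ (fun ω => a * A.indicator (fun _ => 1) ω + g ω + Y ω) =
            ENNReal.ofReal (a * l A + G) + layer μ Y := by
      intro a ha g hg G hG h Y hY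
      simp only [add_assoc]
      rw [layer_add_indicator hμ hA ha fun ω => add_nonneg (hg ω) (hY ω), h Y hY,
        ENNReal.ofReal_add (mul_nonneg ha (hl.2.1 A hA)) hG, add_assoc]
    have hc := max_zero_sub_max_neg_zero_eq_self c
    refine ⟨_, _, _, _, fun ω => add_nonneg (mul_nonneg (le_max_right c 0) (hA0 ω)) (hp ω),
      fun ω => add_nonneg (mul_nonneg (le_max_right (-c) 0) (hA0 ω)) (hq ω),
      add_nonneg (mul_nonneg (le_max_right c 0) (hl.2.1 A hA)) hP,
      add_nonneg (mul_nonneg (le_max_right (-c) 0) (hl.2.1 A hA)) hQ, fun ω => ?_, ?_,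
      ext_nonneg _ (le_max_right _ _) p hp P hP hpY,
      ext_nonneg _ (le_max_right _ _) q hq Q hQ hqY⟩
    · change c * A.indicator (fun _ => 1) ω + f ω = _
      linear_combination hf ω - A.indicator (fun _ => (1 : ℝ)) ω * hc
    · linear_combination hI - l A * hc

/-- The tail integral of a nonnegative simple function plus a nonnegative function splits. -/
lemma SimpleIntegralEq.nonneg_and_layer_add (hl : FAMeasure 𝒜 l) (hμ : IsCut 𝒜 l μ)
    {f : Ω → ℝ} {I : ℝ} (h : SimpleIntegralEq 𝒜 l f I) (hf : ∀ ω, 0 ≤ f ω) :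
    0 ≤ I ∧ ∀ Y : Ω → ℝ, (∀ ω, 0 ≤ Y ω) →
      layer μ (fun ω => f ω + Y ω) = ENNReal.ofReal I + layer μ Y := by
  obtain ⟨p, q, P, Q, hp, hq, hP, hQ, hpq, rfl, hpY, hqY⟩ := h.exists_sub hl hμ
  have key : ∀ Y : Ω → ℝ, (∀ ω, 0 ≤ Y ω) → ENNReal.ofReal Q + layer μ (fun ω => f ω + Y ω) =
      ENNReal.ofReal P + layer μ Y := by
    intro Y hY
    rw [← hpY Y hY, ← hqY _ fun ω => add_nonneg (hf ω) (hY ω)]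
    congr 1
    ext ω
    rw [hpq]; ring
  have hI : Q ≤ P := by
    have h0 := key (fun _ => 0) fun _ => le_rfl
    rw [layer_const_zero hl hμ, add_zero] at h0
    exact (ENNReal.ofReal_le_ofReal_iff hP).1 (le_self_add.trans h0.le)
  refine ⟨sub_nonneg.2 hI, fun Y hY => ?_⟩
  refine (ENNReal.add_right_inj (ENNReal.ofReal_ne_top (r := Q))).1 ?_
  rw [key Y hY, ← add_assoc, ← ENNReal.ofReal_add hQ (sub_nonneg.2 hI), add_sub_cancel]

lemma SimpleIntegralEq.layer_eq (hl : FAMeasure 𝒜 l) (hμ : IsCut 𝒜 l μ)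
    {f : Ω → ℝ} {I : ℝ} (h : SimpleIntegralEq 𝒜 l f I) (hf : ∀ ω, 0 ≤ f ω) :
    layer μ f = ENNReal.ofReal I := by
  simpa [layer_const_zero hl hμ] using
    (h.nonneg_and_layer_add hl hμ hf).2 (fun _ => 0) fun _ => le_rfl

lemma SimpleIntegralEq.mono (hl : FAMeasure 𝒜 l) {f g : Ω → ℝ} {I J : ℝ}
    (hf : SimpleIntegralEq 𝒜 l f I) (hg : SimpleIntegralEq 𝒜 l g J) (h : ∀ ω, f ω ≤ g ω) :
    I ≤ J :=
  sub_nonneg.1 ((hg.sub hf).nonneg_and_layer_add hl (isCut_outer hl)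
    fun ω => sub_nonneg.2 (h ω)).1

/-- A quantitative subadditivity of tail integrals. -/
lemma layer_le_of_le_add {μ ν ρ : Set Ω → ℝ≥0∞} (hν : Monotone ν)
    (hsub : ∀ E F G : Set Ω, E ⊆ F ∪ G → μ E ≤ ν F + ρ G) {Z V W : Ω → ℝ}
    (h : ∀ ω, Z ω ≤ V ω + W ω) {δ : ℝ} (h0 : 0 < δ) (h1 : δ < 1) :
    layer μ Z ≤ ENNReal.ofReal (1 - δ)⁻¹ * layer ν V + ENNReal.ofReal δ⁻¹ * layer ρ W := by
  have hδ : 0 < 1 - δ := sub_pos.2 h1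
  rw [layer, layer, layer, ← setLIntegral_Ioi_comp_mul_left hδ,
    ← setLIntegral_Ioi_comp_mul_left h0, ← lintegral_add_left]
  · refine lintegral_mono fun t => hsub _ _ _ fun ω hω => ?_
    by_contra hc
    simp only [Set.mem_union, Set.mem_ofPred_eq, not_or, not_lt] at hc hω
    linarith [h ω]
  · exact (antitone_tail hν V).measurable.comp (measurable_const_mul _)

lemma ofReal_mul_le_layer (hμ : Monotone μ) (X : Ω → ℝ) (t : ℝ) :
    ENNReal.ofReal t * μ {ω | t < X ω} ≤ layer μ X := by
  calc ENNReal.ofReal t * μ {ω | t < X ω}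
      = ∫⁻ _ in Set.Ioc 0 t, μ {ω | t < X ω} := by simp [mul_comm]
    _ ≤ ∫⁻ s in Set.Ioc 0 t, μ {ω | s < X ω} :=
        setLIntegral_mono' measurableSet_Ioc fun s hs => antitone_tail hμ X hs.2
    _ ≤ layer μ X := lintegral_mono_set Set.Ioc_subset_Ioi_self

lemma le_of_forall_le_ofReal_inv_mul {a b : ℝ≥0∞}
    (h : ∀ δ : ℝ, 0 < δ → δ < 1 → a ≤ ENNReal.ofReal (1 - δ)⁻¹ * b) : a ≤ b := by
  have hc : Tendsto (fun δ : ℝ => ENNReal.ofReal (1 - δ)⁻¹) (nhdsWithin 0 (Set.Ioi 0))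
      (nhds (ENNReal.ofReal (1 - 0)⁻¹)) := by
    refine (ENNReal.tendsto_ofReal ?_).mono_left nhdsWithin_le_nhds
    exact (tendsto_const_nhds.sub tendsto_id).inv₀ (by simp)
  rw [sub_zero, inv_one, ENNReal.ofReal_one] at hc
  have hb := ENNReal.Tendsto.mul_const (b := b) hc (Or.inl one_ne_zero)
  rw [one_mul] at hb
  refine ge_of_tendsto hb ?_
  filter_upwards [Ioo_mem_nhdsGT (zero_lt_one' ℝ)] with δ hδ using h δ hδ.1 hδ.2

lemma sum_zpow_sub_zpow_le {r : ℝ} (hr : 1 < r) (s : Finset ℤ) {x : ℝ} (hx : 0 ≤ x)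
    (h : ∀ k ∈ s, r ^ k ≤ x) : ∑ k ∈ s, (r ^ k - r ^ (k - 1)) ≤ x := by
  induction s using Finset.induction_on_max generalizing x with
  | empty => simpa using hx
  | insert M s hM ih =>
    rw [Finset.sum_insert fun h => (hM M h).false]
    have hs := ih (zpow_pos (zero_lt_one.trans hr) (M - 1)).le fun k hk =>
      zpow_le_zpow_right₀ hr.le (Int.le_sub_one_of_lt (hM k hk))
    linarith [h M (Finset.mem_insert_self M s)]

lemma ofReal_mul_layer_le_tsum (hμ : Monotone μ) (X : Ω → ℝ) {θ : ℝ} (h0 : 0 < θ) (h1 : θ < 1) :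
    ENNReal.ofReal θ * layer μ X ≤
      ∑' k : ℤ, ENNReal.ofReal (θ⁻¹ ^ k - θ⁻¹ ^ (k - 1)) * μ {ω | θ⁻¹ ^ k < X ω} := by
  have hr : 1 < θ⁻¹ := (one_lt_inv₀ h0).2 h1
  have hr0 : θ⁻¹ ≠ 0 := (inv_pos.2 h0).ne'
  have hcov : Set.Ioi (0 : ℝ) ⊆ ⋃ k : ℤ, Set.Ioc (θ⁻¹ ^ k) (θ⁻¹ ^ (k + 1)) := fun t ht =>
    Set.mem_iUnion.2 (exists_mem_Ioc_zpow ht hr)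
  have hle : layer μ X ≤
      ∑' k : ℤ, ENNReal.ofReal (θ⁻¹ ^ (k + 1) - θ⁻¹ ^ k) * μ {ω | θ⁻¹ ^ k < X ω} := by
    refine (lintegral_mono_set hcov).trans ((lintegral_iUnion_le _ _).trans ?_)
    refine ENNReal.tsum_le_tsum fun k => ?_
    refine (setLIntegral_mono' (g := fun _ => μ {ω | θ⁻¹ ^ k < X ω}) measurableSet_Ioc
      fun s hs => antitone_tail hμ X hs.1.le).trans ?_
    simp [mul_comm]
  refine (mul_le_mul_right hle _).trans ?_
  rw [← ENNReal.tsum_mul_left]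
  refine ENNReal.tsum_le_tsum fun k => ?_
  rw [← mul_assoc, ← ENNReal.ofReal_mul h0.le]
  refine le_of_eq ?_
  congr 2
  rw [zpow_add_one₀ hr0, zpow_sub_one₀ hr0]
  field_simp

/-- The tail integral of the inner measure is approximated from below by simple functions. -/
lemma exists_simple_le (hl : FAMeasure 𝒜 l) {X : Ω → ℝ} (hX : ∀ ω, 0 ≤ X ω)
    (hfin : layer (inner 𝒜 l) X < ⊤) {a : ℝ≥0∞} (ha : a < layer (inner 𝒜 l) X) :
    ∃ (f : Ω → ℝ) (I : ℝ), SimpleIntegralEq 𝒜 l f I ∧ (∀ ω, 0 ≤ f ω) ∧ (∀ ω, f ω ≤ X ω) ∧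
      a ≤ ENNReal.ofReal I := by
  obtain ⟨θ, h0, h1, hθ⟩ : ∃ θ : ℝ, 0 < θ ∧ θ < 1 ∧
      a < ENNReal.ofReal θ * (ENNReal.ofReal θ * layer (inner 𝒜 l) X) := by
    have hc : Tendsto (fun θ : ℝ => ENNReal.ofReal (θ * θ) * layer (inner 𝒜 l) X)
        (nhdsWithin 1 (Set.Iio 1)) (nhds (ENNReal.ofReal (1 * 1) * layer (inner 𝒜 l) X)) := by
      refine ENNReal.Tendsto.mul_const ?_ (Or.inr hfin.ne)
      exact (ENNReal.tendsto_ofReal (tendsto_id.mul tendsto_id)).mono_left nhdsWithin_le_nhds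
    rw [mul_one, ENNReal.ofReal_one, one_mul] at hc
    obtain ⟨θ, hθ, h⟩ := ((hc.eventually_const_lt ha).and
      (Ioo_mem_nhdsLT (zero_lt_one' ℝ))).exists
    exact ⟨θ, h.1, h.2, by rwa [← mul_assoc, ← ENNReal.ofReal_mul h.1.le]⟩
  have hr : 0 < θ⁻¹ := inv_pos.2 h0
  have hr1 : 1 < θ⁻¹ := (one_lt_inv₀ h0).2 h1
  have hc : ∀ k : ℤ, 0 ≤ θ⁻¹ ^ k - θ⁻¹ ^ (k - 1) := fun k =>
    sub_nonneg.2 (zpow_le_zpow_right₀ hr1.le (sub_le_self k zero_le_one))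
  have hsum := hθ.trans_le (mul_le_mul_right (ofReal_mul_layer_le_tsum inner_mono X h0 h1) _)
  rw [← ENNReal.tsum_mul_left, ENNReal.tsum_eq_iSup_sum, lt_iSup_iff] at hsum
  obtain ⟨s, hs⟩ := hsum
  have hB : ∀ k : ℤ, ∃ B ∈ 𝒜, B ⊆ {ω | θ⁻¹ ^ k < X ω} ∧
      ENNReal.ofReal θ * inner 𝒜 l {ω | θ⁻¹ ^ k < X ω} ≤ ENNReal.ofReal (l B) := by
    intro k
    have hpos : 0 < θ⁻¹ ^ k := zpow_pos hr k
    have htop : inner 𝒜 l {ω | θ⁻¹ ^ k < X ω} ≠ ⊤ := by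
      intro h
      have := ofReal_mul_le_layer (μ := inner 𝒜 l) inner_mono X (θ⁻¹ ^ k)
      rw [h, ENNReal.mul_top (ENNReal.ofReal_pos.2 hpos).ne'] at this
      exact hfin.not_ge this
    rcases eq_or_ne (inner 𝒜 l {ω | θ⁻¹ ^ k < X ω}) 0 with h | h
    · exact ⟨∅, hl.1.empty_mem, Set.empty_subset _, by rw [h, mul_zero]; exact zero_le⟩
    · have hlt : ENNReal.ofReal θ * inner 𝒜 l {ω | θ⁻¹ ^ k < X ω} <
          inner 𝒜 l {ω | θ⁻¹ ^ k < X ω} := by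
        conv_rhs => rw [← one_mul (inner 𝒜 l _)]
        exact ENNReal.mul_lt_mul_left h htop (by simpa using h1)
      conv_rhs at hlt => rw [inner]
      simp only [lt_iSup_iff] at hlt
      obtain ⟨B, hB, hBX, hlt⟩ := hlt
      exact ⟨B, hB, hBX, hlt.le⟩
  choose B hB hBX hBl using hB
  have hi : ∀ k ω, (0 : ℝ) ≤ (B k).indicator (fun _ => 1) ω := fun k =>
    Set.indicator_nonneg fun _ _ => zero_le_one
  refine ⟨_, _, SimpleIntegralEq.sum (s := s) fun k _ =>
    SimpleIntegralEq.indicator (hB k) (θ⁻¹ ^ k - θ⁻¹ ^ (k - 1)),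
    fun ω => Finset.sum_nonneg fun k _ => mul_nonneg (hc k) (hi k ω), fun ω => ?_, ?_⟩
  · classical
    have : ∑ k ∈ s, (θ⁻¹ ^ k - θ⁻¹ ^ (k - 1)) * (B k).indicator (fun _ => 1) ω =
        ∑ k ∈ s with ω ∈ B k, (θ⁻¹ ^ k - θ⁻¹ ^ (k - 1)) := by
      simp only [Set.indicator_apply, mul_ite, mul_one, mul_zero, Finset.sum_filter]
    rw [this]
    exact sum_zpow_sub_zpow_le hr1 _ (hX ω) fun k hk =>
      le_of_lt (hBX k (Finset.mem_filter.1 hk).2)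
  · refine hs.le.trans ?_
    rw [ENNReal.ofReal_sum_of_nonneg fun k _ => mul_nonneg (hc k) (hl.2.1 _ (hB k))]
    refine Finset.sum_le_sum fun k _ => ?_
    rw [ENNReal.ofReal_mul (hc k), mul_left_comm]
    exact mul_le_mul_right (hBl k) _

lemma layer_abs_sub_le_of_cauchy (hl : FAMeasure 𝒜 l) {g : ℕ → Ω → ℝ} {X : Ω → ℝ}
    (hconv : ConvInMeasure 𝒜 l g X) {ε : ℝ} {N n : ℕ}
    (h : ∀ m ≥ N, ∃ I : ℝ, SimpleIntegralEq 𝒜 l (fun ω => |g m ω - g n ω|) I ∧ I < ε) :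
    layer (outer 𝒜 l) (fun ω => |g n ω - X ω|) ≤ ENNReal.ofReal (2 * ε) := by
  have hpt : ∀ t ∈ Set.Ioi (0 : ℝ), outer 𝒜 l {ω | 2 * t < |g n ω - X ω|} ≤
      liminf (fun m => outer 𝒜 l {ω | t < |g m ω - g n ω|}) atTop := by
    intro t ht
    refine ENNReal.le_of_forall_pos_le_add fun η hη _ => ?_
    rw [← tsub_le_iff_right]
    refine le_liminf_of_le (by isBoundedDefault) ?_
    filter_upwards [(hconv t ht).eventually_le_const (ENNReal.coe_pos.2 hη)] with m hm
    rw [tsub_le_iff_right]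
    refine (outer_le_add hl ?_).trans (add_le_add_right hm _)
    intro ω hω
    by_contra hc
    simp only [Set.mem_union, Set.mem_ofPred_eq, not_or, not_lt] at hc hω
    have := abs_sub_le (g n ω) (g m ω) (X ω)
    rw [abs_sub_comm (g n ω) (g m ω)] at this
    linarith
  have hfatou : ∫⁻ t in Set.Ioi (0 : ℝ), outer 𝒜 l {ω | 2 * t < |g n ω - X ω|} ≤
      ENNReal.ofReal ε := by
    refine (setLIntegral_mono' measurableSet_Ioi hpt).trans ?_
    refine (lintegral_liminf_le fun m => (antitone_tail outer_mono _).measurable).trans ?_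
    refine liminf_le_of_frequently_le' (Eventually.frequently ?_)
    filter_upwards [eventually_ge_atTop N] with m hm
    obtain ⟨I, hI, hlt⟩ := h m hm
    exact (hI.layer_eq hl (isCut_outer hl) fun ω => abs_nonneg _).le.trans
      (ENNReal.ofReal_le_ofReal hlt.le)
  rw [setLIntegral_Ioi_comp_mul_left zero_lt_two
    fun t => outer 𝒜 l {ω | t < |g n ω - X ω|}] at hfatou
  rw [ENNReal.ofReal_mul zero_le_two]
  refine le_trans (le_of_eq ?_) (mul_le_mul_right hfatou _)
  rw [← mul_assoc, ← ENNReal.ofReal_mul zero_le_two, mul_inv_cancel₀ two_ne_zero,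
    ENNReal.ofReal_one, one_mul, layer]

lemma tendsto_layer_abs_sub (hl : FAMeasure 𝒜 l) {g : ℕ → Ω → ℝ} {X : Ω → ℝ}
    (hconv : ConvInMeasure 𝒜 l g X) (hcauchy : CauchyL1 𝒜 l g) :
    Tendsto (fun n => layer (outer 𝒜 l) fun ω => |g n ω - X ω|) atTop (nhds 0) := by
  refine ENNReal.tendsto_atTop_zero.2 fun ε hε => ?_
  obtain ⟨δ, hδ, hδε⟩ := ENNReal.lt_iff_exists_nnreal_btwn.1 hε
  obtain ⟨N, hN⟩ := hcauchy (δ / 2) (half_pos (by exact_mod_cast hδ))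
  refine ⟨N, fun n hn => ?_⟩
  refine (layer_abs_sub_le_of_cauchy hl hconv fun m hm => hN m hm n hn).trans ?_
  rw [mul_div_cancel₀ _ two_ne_zero, ENNReal.ofReal_coe_nnreal]
  exact hδε.le

lemma HasIntegral.layer_bounds (hl : FAMeasure 𝒜 l) {X : Ω → ℝ} (hX : ∀ ω, 0 ≤ X ω) {I : ℝ}
    (h : HasIntegral 𝒜 l X I) :
    ENNReal.ofReal I ≤ layer (inner 𝒜 l) X ∧ layer (outer 𝒜 l) X ≤ ENNReal.ofReal I := by
  obtain ⟨g, J, -, hconv, hcauchy, hJ, hJI⟩ := h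
  set e : ℕ → ℝ≥0∞ := fun n => layer (outer 𝒜 l) fun ω => |g n ω - X ω|
  have he : Tendsto e atTop (nhds 0) := tendsto_layer_abs_sub hl hconv hcauchy
  have hJ' : Tendsto (fun n => ENNReal.ofReal (J n)) atTop (nhds (ENNReal.ofReal I)) :=
    ENNReal.tendsto_ofReal hJI
  choose K hK using fun n => (hJ n).exists_comp hl (φ := fun x => max x 0) (by simp)
  have hpos : ∀ n ω, 0 ≤ max (g n ω) 0 := fun n ω => le_max_right _ _
  have hlim : ∀ (δ : ℝ) (u : ℕ → ℝ≥0∞) (b : ℝ≥0∞), Tendsto u atTop (nhds b) →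
      Tendsto (fun n => ENNReal.ofReal (1 - δ)⁻¹ * u n + ENNReal.ofReal δ⁻¹ * e n) atTop
        (nhds (ENNReal.ofReal (1 - δ)⁻¹ * b)) := by
    intro δ u b hu
    have := (ENNReal.Tendsto.const_mul hu (Or.inr (ENNReal.ofReal_ne_top (r := (1 - δ)⁻¹)))).add
      (ENNReal.Tendsto.const_mul he (Or.inr (ENNReal.ofReal_ne_top (r := δ⁻¹))))
    rwa [mul_zero, add_zero] at this
  constructor <;> refine le_of_forall_le_ofReal_inv_mul fun δ h0 h1 => ?_
  · refine le_of_tendsto_of_tendsto' hJ' (hlim δ _ _ tendsto_const_nhds) fun n => ?_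
    refine (ENNReal.ofReal_le_ofReal ((hJ n).mono hl (hK n) fun ω => le_max_left _ _)).trans ?_
    rw [← (hK n).layer_eq hl (isCut_inner hl) (hpos n)]
    refine layer_le_of_le_add inner_mono (fun E F G => inner_le_add hl) (fun ω => ?_) h0 h1
    exact max_le (by linarith [le_abs_self (g n ω - X ω)])
      (add_nonneg (hX ω) (abs_nonneg _))
  · have hKe : ∀ n, ENNReal.ofReal (K n) ≤ ENNReal.ofReal (J n) + e n := by
      intro n
      have hneg := (hK n).sub (hJ n)
      have h0 : ∀ ω, 0 ≤ max (g n ω) 0 - g n ω := fun ω => sub_nonneg.2 (le_max_left _ _)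
      have hle : ENNReal.ofReal (K n - J n) ≤ e n := by
        rw [← hneg.layer_eq hl (isCut_outer hl) h0]
        refine layer_mono outer_mono fun ω => ?_
        rw [← max_sub_sub_right, sub_self]
        exact max_le (abs_nonneg _) (by linarith [neg_abs_le (g n ω - X ω), hX ω])
      refine le_trans ?_ (add_le_add_right hle _)
      simpa using ENNReal.ofReal_add_le (p := J n) (q := K n - J n)
    have hJe := hJ'.add he
    rw [add_zero] at hJe
    refine ge_of_tendsto' (hlim δ _ _ hJe) fun n => ?_
    refine (layer_le_of_le_add (V := fun ω => max (g n ω) 0) outer_mono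
      (fun E F G => outer_le_add hl) (fun ω => ?_) h0 h1).trans
      (add_le_add_left (mul_le_mul_right ?_ _) _)
    · linarith [neg_abs_le (g n ω - X ω), le_max_left (g n ω) 0]
    · rw [(hK n).layer_eq hl (isCut_outer hl) (hpos n)]
      exact hKe n

lemma memL1_of_layer_eq (hl : FAMeasure 𝒜 l) {X : Ω → ℝ} (hX : ∀ ω, 0 ≤ X ω)
    (heq : layer (inner 𝒜 l) X = layer (outer 𝒜 l) X) (hfin : layer (outer 𝒜 l) X < ⊤) :
    MemL1 𝒜 l X := by
  set L := (layer (inner 𝒜 l) X).toReal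
  have hLtop : layer (inner 𝒜 l) X ≠ ⊤ := heq ▸ hfin.ne
  have hLI : layer (inner 𝒜 l) X = ENNReal.ofReal L := (ENNReal.ofReal_toReal hLtop).symm
  have hex : ∀ n : ℕ, ∃ (f : Ω → ℝ) (I : ℝ), SimpleIntegralEq 𝒜 l f I ∧ (∀ ω, 0 ≤ f ω) ∧
      (∀ ω, f ω ≤ X ω) ∧ L - 1 / ((n : ℝ) + 1) ≤ I := by
    intro n
    have hn : (0 : ℝ) < 1 / ((n : ℝ) + 1) := Nat.one_div_pos_of_nat
    rcases le_or_gt (L - 1 / ((n : ℝ) + 1)) 0 with h | h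
    · exact ⟨fun _ => 0, 0, .zero, fun _ => le_rfl, hX, h⟩
    · obtain ⟨f, I, hfI, hf0, hfX, ha⟩ := exists_simple_le hl hX hLtop.lt_top
        (a := ENNReal.ofReal (L - 1 / ((n : ℝ) + 1)))
        (by rw [hLI]; exact (ENNReal.ofReal_lt_ofReal_iff (by linarith)).2 (by linarith))
      refine ⟨f, I, hfI, hf0, hfX, ?_⟩
      exact (ENNReal.ofReal_le_ofReal_iff (hfI.nonneg_and_layer_add hl (isCut_inner hl) hf0).1).1 ha
  choose f I hfI hf0 hfX hI using hex
  have hle : ∀ {g : Ω → ℝ} {J : ℝ}, SimpleIntegralEq 𝒜 l g J → (∀ ω, 0 ≤ g ω) →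
      (∀ ω, g ω ≤ X ω) → J ≤ L := by
    intro g J hg hg0 hgX
    rw [← ENNReal.ofReal_le_ofReal_iff ENNReal.toReal_nonneg, ← hLI,
      ← hg.layer_eq hl (isCut_inner hl) hg0]
    exact layer_mono inner_mono hgX
  refine ⟨L, f, I, fun n => (hfI n).isSimple, fun c hc => ?_, fun ε hε => ?_, hfI, ?_⟩
  · have hb : ∀ n, outer 𝒜 l {ω | c < |f n ω - X ω|} ≤
        ENNReal.ofReal (c⁻¹ * (1 / ((n : ℝ) + 1))) := by
      intro n
      have h0 : ∀ ω, 0 ≤ X ω - f n ω := fun ω => sub_nonneg.2 (hfX n ω)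
      obtain ⟨hIn, hsplit⟩ := (hfI n).nonneg_and_layer_add hl (isCut_outer hl) (hf0 n)
      have hsplit := hsplit _ h0
      simp only [add_sub_cancel] at hsplit
      have hd : layer (outer 𝒜 l) (fun ω => X ω - f n ω) ≤
          ENNReal.ofReal (1 / ((n : ℝ) + 1)) := by
        refine (ENNReal.add_le_add_iff_left (ENNReal.ofReal_ne_top (r := I n))).1 ?_
        rw [← hsplit, ← ENNReal.ofReal_add hIn Nat.one_div_pos_of_nat.le, ← heq, hLI]
        exact ENNReal.ofReal_le_ofReal (by linarith [hI n])
      have hm := (ofReal_mul_le_layer outer_mono (fun ω => X ω - f n ω) c).trans hd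
      have habs : {ω | c < |f n ω - X ω|} = {ω | c < X ω - f n ω} := by
        ext ω; rw [Set.mem_ofPred_eq, abs_sub_comm, abs_of_nonneg (h0 ω)]; rfl
      rw [habs, ENNReal.ofReal_mul (inv_pos.2 hc).le, ENNReal.ofReal_inv_of_pos hc]
      rw [mul_comm] at hm
      rw [mul_comm, ← div_eq_mul_inv]
      exact (ENNReal.le_div_iff_mul_le (Or.inl (ENNReal.ofReal_pos.2 hc).ne')
        (Or.inl ENNReal.ofReal_ne_top)).2 hm
    refine tendsto_of_tendsto_of_tendsto_of_le_of_le tendsto_const_nhds ?_ (fun _ => zero_le) hb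
    rw [← ENNReal.ofReal_zero, ← mul_zero c⁻¹]
    exact ENNReal.tendsto_ofReal (tendsto_one_div_add_atTop_nhds_zero_nat.const_mul _)
  · obtain ⟨N, hN⟩ := exists_nat_one_div_lt (half_pos hε)
    refine ⟨N, fun m hm n hn => ?_⟩
    obtain ⟨D, hD⟩ := ((hfI m).sub (hfI n)).exists_comp hl (φ := fun x => |x|) abs_zero
    refine ⟨D, hD, ?_⟩
    have hmax := (((hfI m).add (hfI n)).add hD).smul (1 / 2)
    have hmaxle := hle hmax (fun ω => by have := hf0 m ω; have := hf0 n ω; positivity) fun ω => by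
      rcases abs_cases (f m ω - f n ω) with ⟨h, -⟩ | ⟨h, -⟩ <;> rw [h] <;>
        linarith [hfX m ω, hfX n ω]
    have h1 := hI m
    have h2 := hI n
    have h3 := Nat.one_div_le_one_div (α := ℝ) hm
    have h4 := Nat.one_div_le_one_div (α := ℝ) hn
    linarith
  · refine tendsto_of_tendsto_of_tendsto_of_le_of_le (g := fun n : ℕ => L - 1 / ((n : ℝ) + 1))
      ?_ tendsto_const_nhds hI fun n => hle (hfI n) (hf0 n) (hfX n)
    simpa using tendsto_one_div_add_atTop_nhds_zero_nat.const_sub L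

end FA

open FA MeasureTheory

/-- layer-cake. For `X ≥ 0`, `X ∈ L¹(l)` iff
`∫₀^∞ l_*(X > t) dt = ∫₀^∞ l*(X > t) dt < ∞`, and then `∫ X dl = ∫₀^∞ l_*(X > t) dt`. -/
theorem stmt3 {Ω : Type*} (𝒜 : Set (Set Ω)) (l : Set Ω → ℝ)
    (hl : FAMeasure 𝒜 l) (X : Ω → ℝ) (hX : ∀ ω, 0 ≤ X ω) :
    (MemL1 𝒜 l X ↔
      (∫⁻ t in Set.Ioi (0 : ℝ), inner 𝒜 l {ω | t < X ω}) =
        (∫⁻ t in Set.Ioi (0 : ℝ), outer 𝒜 l {ω | t < X ω}) ∧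
      (∫⁻ t in Set.Ioi (0 : ℝ), outer 𝒜 l {ω | t < X ω}) < ⊤) ∧
    ∀ I : ℝ, HasIntegral 𝒜 l X I →
      ENNReal.ofReal I = ∫⁻ t in Set.Ioi (0 : ℝ), inner 𝒜 l {ω | t < X ω} := by
  have hle : layer (inner 𝒜 l) X ≤ layer (outer 𝒜 l) X :=
    lintegral_mono fun _ => inner_le_outer hl _
  have heq : ∀ I : ℝ, HasIntegral 𝒜 l X I → ENNReal.ofReal I = layer (inner 𝒜 l) X := fun I h =>
    le_antisymm (h.layer_bounds hl hX).1 (hle.trans (h.layer_bounds hl hX).2)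
  refine ⟨⟨fun ⟨I, h⟩ => ⟨?_, ?_⟩, fun h => memL1_of_layer_eq hl hX h.1 h.2⟩, heq⟩
  · exact le_antisymm hle ((h.layer_bounds hl hX).2.trans (h.layer_bounds hl hX).1)
  · exact (h.layer_bounds hl hX).2.trans_lt ENNReal.ofReal_lt_top
end

section
/- Let H be a vector space of real-valued functions on a set S, φ a linear functional on H, and V ⊆ S an H-bounded set (sup_{v ∈ V} |h(v)| < ∞ for all h ∈ H). Then φ(h) ≥ inf_{v ∈ V} h(v) for all h ∈ H if and only if there exists a finitely additive probability μ on a ring of subsets of V such that every h ∈ H (restricted to V) is μ-integrable and φ(h) = ∫_V h dμ for all h ∈ H. -/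
open scoped ENNReal
open MeasureTheory Filter

open FA MeasureTheory

namespace FA

variable {Ω : Type*}

theorem sum_mul_measure_inter_nonneg {ι : Type*} {𝒜 : Set (Set Ω)} {l : Set Ω → ℝ}
    (hl : FAMeasure 𝒜 l) (s : Finset ι) (A : ι → Set Ω) (c : ι → ℝ) (hA : ∀ i ∈ s, A i ∈ 𝒜)
    {B : Set Ω} (hB : B ∈ 𝒜) (d : ℝ)
    (hnonneg : ∀ ω ∈ B, 0 ≤ d + ∑ i ∈ s, c i * (A i).indicator (fun _ => (1 : ℝ)) ω) :
    0 ≤ d * l B + ∑ i ∈ s, c i * l (A i ∩ B) := by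
  classical
  obtain ⟨hring, hpos, hempty, hadd⟩ := hl
  have split : ∀ X ∈ 𝒜, ∀ Y ∈ 𝒜, l X = l (X ∩ Y) + l (X \ Y) := fun X hX Y hY => by
    rw [← hadd _ (hring.inter_mem hX hY) _ (hring.sdiff_mem hX hY)
      (Set.disjoint_sdiff_right.mono_left Set.inter_subset_right), Set.inter_union_sdiff]
  induction s using Finset.induction_on generalizing B d with
  | empty =>
    simp only [Finset.sum_empty, add_zero] at hnonneg ⊢
    rcases B.eq_empty_or_nonempty with rfl | ⟨ω, hω⟩
    · simp [hempty]
    · exact mul_nonneg (hnonneg ω hω) (hpos B hB)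
  | insert a s ha ih =>
    have hAa : A a ∈ 𝒜 := hA a (Finset.mem_insert_self a s)
    have hAs : ∀ i ∈ s, A i ∈ 𝒜 := fun i hi => hA i (Finset.mem_insert_of_mem hi)
    simp only [Finset.sum_insert ha] at hnonneg ⊢
    have inside := ih hAs (hring.inter_mem hB hAa) (d + c a) fun ω hω => by
      simpa [Set.indicator_of_mem hω.2, add_assoc] using hnonneg ω hω.1
    have outside := ih hAs (hring.sdiff_mem hB hAa) d fun ω hω => by
      simpa [Set.indicator_of_notMem hω.2] using hnonneg ω hω.1
    have hsum : ∑ i ∈ s, c i * l (A i ∩ B) =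
        ∑ i ∈ s, c i * l (A i ∩ (B ∩ A a)) + ∑ i ∈ s, c i * l (A i ∩ (B \ A a)) := by
      rw [← Finset.sum_add_distrib]
      refine Finset.sum_congr rfl fun i hi => ?_
      rw [split _ (hring.inter_mem (hAs i hi) hB) _ hAa, Set.inter_assoc, Set.inter_sdiff_assoc,
        mul_add]
    rw [hsum, split B hB _ hAa, Set.inter_comm (A a) B]
    linarith

theorem IsSimple.exists_lower_bound {𝒜 : Set (Set Ω)} {f : Ω → ℝ} (hf : IsSimple 𝒜 f) :
    ∃ K : ℝ, ∀ ω, -K ≤ f ω := by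
  obtain ⟨s, c, -, hf⟩ := hf
  refine ⟨∑ A ∈ s, |c A|, fun ω => ?_⟩
  rw [hf, ← Finset.sum_neg_distrib]
  refine Finset.sum_le_sum fun A _ => ?_
  by_cases hω : ω ∈ A
  · simpa [hω] using neg_abs_le (c A)
  · simp [hω]

theorem HasIntegral.le_of_forall_le {𝒜 : Set (Set Ω)} {l : Set Ω → ℝ} (hl : FAMeasure 𝒜 l)
    (huniv : Set.univ ∈ 𝒜) (hone : l Set.univ = 1) {f : Ω → ℝ} {I m : ℝ}
    (hf : HasIntegral 𝒜 l f I) (hm : ∀ ω, m ≤ f ω) : m ≤ I := by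
  obtain ⟨g, J, hg, hconv, hcauchy, hJ, hlim⟩ := hf
  refine le_of_forall_pos_le_add fun ε hε => ?_
  obtain ⟨N, hN⟩ := hcauchy (ε / 3) (by positivity)
  obtain ⟨K, hK, hgK⟩ : ∃ K : ℝ, 0 ≤ K ∧ ∀ ω, m - K ≤ g N ω := by
    obtain ⟨K, hK⟩ := (hg N).exists_lower_bound
    exact ⟨|m| + |K|, by positivity, fun ω => by
      linarith [hK ω, le_abs_self m, le_abs_self K]⟩
  rw [← sub_le_iff_le_add]
  refine ge_of_tendsto hlim ?_
  have hsmall := (hconv (ε / 3) (by positivity)).eventually_lt_const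
    (ENNReal.ofReal_pos.2 (show 0 < ε / (3 * (K + 1)) by positivity))
  filter_upwards [hsmall, eventually_ge_atTop N] with n hn hNn
  simp only [outer, iInf_lt_iff] at hn
  obtain ⟨B, hB, hEB, hlB⟩ := hn
  have hlB : l B < ε / (3 * (K + 1)) := (ENNReal.ofReal_lt_ofReal_iff (by positivity)).1 hlB
  have hKB : K * l B ≤ ε / 3 := by
    rw [lt_div_iff₀ (by positivity)] at hlB
    nlinarith [hl.2.1 B hB]
  obtain ⟨D, ⟨s₂, c₂, hs₂, hD, rfl⟩, hDε⟩ := hN n hNn N le_rfl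
  obtain ⟨s₁, c₁, hs₁, hgn, hJn⟩ := hJ n
  have key := sum_mul_measure_inter_nonneg hl (s₁.disjSum (s₂.disjSum {()}))
    (Sum.elim id (Sum.elim id fun _ => B)) (Sum.elim c₁ (Sum.elim c₂ fun _ => K))
    (by
      simp only [Finset.mem_disjSum, Finset.mem_singleton]
      rintro _ (⟨A, hA, rfl⟩ | ⟨_, (⟨A, hA, rfl⟩ | ⟨_, _, rfl⟩), rfl⟩)
      exacts [hs₁ A hA, hs₂ A hA, hB])
    huniv (-(m - ε / 3)) (by
      intro ω _
      simp only [Finset.sum_disjSum, Sum.elim_inl, Sum.elim_inr, id, Finset.sum_singleton,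
        ← hgn, ← hD]
      by_cases hω : ω ∈ B
      · simp only [Set.indicator_of_mem hω]
        linarith [hgK ω, neg_abs_le (g n ω - g N ω)]
      · simp only [Set.indicator_of_notMem hω]
        have hclose : |g n ω - f ω| ≤ ε / 3 := not_lt.1 fun h => hω (hEB h)
        linarith [hm ω, neg_abs_le (g n ω - f ω), abs_nonneg (g n ω - g N ω)])
  simp only [Finset.sum_disjSum, Sum.elim_inl, Sum.elim_inr, id, Finset.sum_singleton,
    Set.inter_univ, hone, ← hJn] at key
  linarith

/-- The submodule of bounded real-valued functions. -/
def boundedFunctions (Ω : Type*) : Submodule ℝ (Ω → ℝ) where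
  carrier := {f | ∃ M : ℝ, ∀ ω, |f ω| ≤ M}
  zero_mem' := ⟨0, fun ω => by simp⟩
  add_mem' := by
    rintro f g ⟨M, hM⟩ ⟨M', hM'⟩
    exact ⟨M + M', fun ω => (abs_add_le _ _).trans (add_le_add (hM ω) (hM' ω))⟩
  smul_mem' := by
    rintro a f ⟨M, hM⟩
    exact ⟨|a| * M, fun ω => by
      simpa [abs_mul] using mul_le_mul_of_nonneg_left (hM ω) (abs_nonneg a)⟩

theorem bddAbove_range_of_abs_le {f : Ω → ℝ} (hf : ∃ M : ℝ, ∀ ω, |f ω| ≤ M) :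
    BddAbove (Set.range f) := by
  obtain ⟨M, hM⟩ := hf
  exact ⟨M, by rintro _ ⟨ω, rfl⟩; exact (le_abs_self _).trans (hM ω)⟩

/-- Hahn–Banach: a functional dominated by the supremum on a space of bounded functions extends
to a functional dominated by the supremum on all bounded functions. -/
theorem exists_extension_le_iSup [Nonempty Ω] {H : Type*} [AddCommGroup H] [Module ℝ H]
    (r : H →ₗ[ℝ] Ω → ℝ) (φ : H →ₗ[ℝ] ℝ) (hbdd : ∀ h, ∃ M : ℝ, ∀ ω, |r h ω| ≤ M)
    (hφ : ∀ h, φ h ≤ ⨆ ω, r h ω) :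
    ∃ L : (Ω → ℝ) →ₗ[ℝ] ℝ, (∀ h, L (r h) = φ h) ∧
      ∀ (f : Ω → ℝ) (C : ℝ), (∃ M : ℝ, ∀ ω, |f ω| ≤ M) → (∀ ω, f ω ≤ C) → L f ≤ C := by
  let r' : H →ₗ[ℝ] boundedFunctions Ω := r.codRestrict _ hbdd
  obtain ⟨ψ, hψ⟩ : φ ∈ LinearMap.range r.dualMap := by
    rw [LinearMap.range_dualMap_eq_dualAnnihilator_ker, Submodule.mem_dualAnnihilator]
    intro h h0
    rw [LinearMap.mem_ker] at h0
    refine le_antisymm ?_ ?_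
    · simpa [h0] using hφ h
    · simpa [h0] using hφ (-h)
  have hψr : ∀ h, ψ (r h) = φ h := LinearMap.congr_fun hψ
  obtain ⟨g, hg, hgle⟩ := exists_extension_of_le_sublinear
    (⟨LinearMap.range r', ψ ∘ₗ (boundedFunctions Ω).subtype ∘ₗ (LinearMap.range r').subtype⟩ :
      boundedFunctions Ω →ₗ.[ℝ] ℝ) (fun f => ⨆ ω, f.1 ω)
    (fun c hc x => by
      simp only [Submodule.coe_smul, Pi.smul_apply, smul_eq_mul]
      exact (Real.mul_iSup_of_nonneg hc.le _).symm)
    (fun x y => ciSup_le fun ω => add_le_add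
      (le_ciSup (bddAbove_range_of_abs_le x.2) ω) (le_ciSup (bddAbove_range_of_abs_le y.2) ω))
    (by
      rintro ⟨_, h, rfl⟩
      exact (hψr h).trans_le (hφ h))
  obtain ⟨L, hL⟩ := g.exists_extend
  have hLg : ∀ f : boundedFunctions Ω, L f.1 = g f := LinearMap.congr_fun hL
  refine ⟨L, fun h => ?_, fun f C hf hC => ?_⟩
  · rw [show r h = (r' h).1 from rfl, hLg, hg ⟨r' h, LinearMap.mem_range_self r' h⟩]
    exact hψr h
  · rw [hLg ⟨f, hf⟩]
    exact (hgle _).trans (ciSup_le hC)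

theorem simpleIntegralEq_of_finite_range (L : (Ω → ℝ) →ₗ[ℝ] ℝ) {f : Ω → ℝ}
    (hf : (Set.range f).Finite) :
    SimpleIntegralEq Set.univ (fun A => L (A.indicator fun _ => 1)) f (L f) := by
  classical
  set s : Finset (Set Ω) := hf.toFinset.image fun y => f ⁻¹' {y}
  set c : Set Ω → ℝ := fun A => if h : A.Nonempty then f h.some else 0 with hc
  have hsum : ∀ ω, f ω = ∑ A ∈ s, c A * A.indicator (fun _ => (1 : ℝ)) ω := fun ω => by
    rw [Finset.sum_eq_single (f ⁻¹' {f ω})]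
    · have hne : (f ⁻¹' {f ω}).Nonempty := ⟨ω, rfl⟩
      have hsome : f hne.some = f ω := hne.some_mem
      simp [hc, dif_pos hne, hsome]
    · intro A hA hAne
      obtain ⟨y, -, rfl⟩ := Finset.mem_image.1 hA
      rw [Set.indicator_of_notMem, mul_zero]
      rintro rfl
      exact hAne rfl
    · intro h
      exact (h (Finset.mem_image.2 ⟨f ω, by simp, rfl⟩)).elim
  refine ⟨s, c, fun _ _ => Set.mem_univ _, hsum, ?_⟩
  have hfun : f = ∑ A ∈ s, c A • A.indicator (fun _ => (1 : ℝ)) := by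
    ext ω
    simpa [Finset.sum_apply] using hsum ω
  conv_lhs => rw [hfun]
  simp

theorem hasIntegral_of_bounded (L : (Ω → ℝ) →ₗ[ℝ] ℝ)
    (hL : ∀ (f : Ω → ℝ) (C : ℝ), (∃ M : ℝ, ∀ ω, |f ω| ≤ M) → (∀ ω, f ω ≤ C) → L f ≤ C)
    {f : Ω → ℝ} (hf : ∃ M : ℝ, ∀ ω, |f ω| ≤ M) :
    HasIntegral Set.univ (fun A => L (A.indicator fun _ => 1)) f (L f) := by
  obtain ⟨M, hM⟩ := hf
  set g : ℕ → Ω → ℝ := fun n ω => (⌊f ω * (n + 1)⌋ : ℝ) / (n + 1) with hgdef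
  have hfin : ∀ n, (Set.range (g n)).Finite := fun n => by
    refine ((Set.finite_Icc ⌊-M * (n + 1)⌋ ⌊M * (n + 1)⌋).image
      fun k : ℤ => (k : ℝ) / (n + 1)).subset ?_
    rintro _ ⟨ω, rfl⟩
    have := abs_le.1 (hM ω)
    refine ⟨_, ⟨Int.floor_le_floor ?_, Int.floor_le_floor ?_⟩, rfl⟩
    · exact mul_le_mul_of_nonneg_right this.1 (by positivity)
    · exact mul_le_mul_of_nonneg_right this.2 (by positivity)
  have hclose : ∀ n ω, |g n ω - f ω| ≤ 1 / ((n : ℝ) + 1) := fun n ω => by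
    have hn : (0 : ℝ) < n + 1 := by positivity
    have h1 : g n ω ≤ f ω := (div_le_iff₀ hn).2 (Int.floor_le _)
    have h2 : f ω ≤ g n ω + 1 / (n + 1) := by
      rw [hgdef, ← add_div, le_div_iff₀ hn]
      exact (Int.lt_floor_add_one _).le
    rw [abs_le]
    constructor <;> linarith [show (0 : ℝ) < 1 / (n + 1) by positivity]
  have hint := fun n => simpleIntegralEq_of_finite_range L (hfin n)
  have hzero := tendsto_one_div_add_atTop_nhds_zero_nat (𝕜 := ℝ)
  refine ⟨g, fun n => L (g n), fun n => ?_, fun c hc => ?_, fun ε hε => ?_, hint, ?_⟩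
  · obtain ⟨s, c, hs, hsum, -⟩ := hint n
    exact ⟨s, c, hs, hsum⟩
  · refine tendsto_const_nhds.congr' ?_
    filter_upwards [hzero.eventually_lt_const hc] with n hn
    have hE : {ω | c < |g n ω - f ω|} = ∅ :=
      Set.eq_empty_of_forall_notMem fun ω hω => absurd ((hclose n ω).trans_lt hn) hω.not_gt
    rw [hE, eq_comm, ← nonpos_iff_eq_zero, outer]
    refine iInf₂_le_of_le ∅ trivial (iInf_le_of_le subset_rfl ?_)
    simp only [Set.indicator_empty]
    exact (ENNReal.ofReal_eq_zero.2 (map_zero L).le).le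
  · obtain ⟨N, hN⟩ := eventually_atTop.1
      (hzero.eventually_lt_const (show 0 < ε / 3 by positivity))
    refine ⟨N, fun m hm n hn => ⟨_, simpleIntegralEq_of_finite_range L ?_, ?_⟩⟩
    · refine ((hfin m).image2 (fun x y => |x - y|) (hfin n)).subset ?_
      rintro _ ⟨ω, rfl⟩
      exact ⟨_, ⟨ω, rfl⟩, _, ⟨ω, rfl⟩, rfl⟩
    · have hb : ∀ ω, |g m ω - g n ω| ≤ 2 * ε / 3 := fun ω => by
        have := abs_sub_le (g m ω) (f ω) (g n ω)
        rw [abs_sub_comm (f ω)] at this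
        linarith [hclose m ω, hclose n ω, hN m hm, hN n hn]
      exact (hL _ _ ⟨_, fun ω => (abs_abs _).trans_le (hb ω)⟩ hb).trans_lt (by linarith)
  · rw [tendsto_iff_norm_sub_tendsto_zero]
    refine squeeze_zero (fun _ => norm_nonneg _) (fun n => ?_) hzero
    rw [Real.norm_eq_abs, ← map_sub, abs_le]
    have hle := hL (g n - f) _ ⟨_, hclose n⟩ fun ω => (le_abs_self _).trans (hclose n ω)
    have hclose' : ∀ ω, |(f - g n) ω| ≤ 1 / ((n : ℝ) + 1) := fun ω =>
      (abs_sub_comm _ _).trans_le (hclose n ω)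
    have hge := hL (f - g n) _ ⟨_, hclose'⟩ fun ω => (le_abs_self _).trans (hclose' ω)
    rw [← neg_sub, map_neg] at hge
    exact ⟨by linarith, hle⟩

theorem faMeasure_of_linearMap (L : (Ω → ℝ) →ₗ[ℝ] ℝ)
    (hL : ∀ (f : Ω → ℝ) (C : ℝ), (∃ M : ℝ, ∀ ω, |f ω| ≤ M) → (∀ ω, f ω ≤ C) → L f ≤ C) :
    FAMeasure Set.univ fun A => L (A.indicator fun _ => 1) := by
  refine ⟨⟨trivial, fun _ _ _ _ => trivial, fun _ _ _ _ => trivial⟩, fun A _ => ?_, ?_,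
    fun A _ B _ hAB => ?_⟩
  · have h := hL (-A.indicator fun _ => 1) 0
      ⟨1, fun ω => by by_cases hω : ω ∈ A <;> simp [hω]⟩
      fun ω => by by_cases hω : ω ∈ A <;> simp [hω]
    rw [map_neg] at h
    linarith
  · simp only [Set.indicator_empty]
    exact map_zero L
  · change L _ = L _ + L _
    rw [Set.indicator_union_of_disjoint hAB, ← map_add]
    rfl

end FA

/-- Corollary: Choquet-type representation over an `H`-bounded set `V`:
`φ(h) ≥ inf_{v ∈ V} h(v)` for all `h ∈ H` iff `φ` is represented as the integral over
`V` with respect to a finitely additive probability on a ring of subsets of `V`. -/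
theorem stmt7 {S : Type*} (H : Submodule ℝ (S → ℝ)) (φ : H →ₗ[ℝ] ℝ)
    (V : Set S) (hVne : V.Nonempty)
    (hbdd : ∀ h : H, ∃ M : ℝ, ∀ v ∈ V, |(h : S → ℝ) v| ≤ M) :
    (∀ h : H, sInf ((h : S → ℝ) '' V) ≤ φ h) ↔
      ∃ (𝒜 : Set (Set V)) (μ : Set V → ℝ), FAMeasure 𝒜 μ ∧
        Set.univ ∈ 𝒜 ∧ μ Set.univ = 1 ∧
        ∀ h : H, HasIntegral 𝒜 μ (fun v : V => (h : S → ℝ) v) (φ h) := by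
  have : Nonempty V := hVne.to_subtype
  have hbdd' : ∀ h : H, ∃ M : ℝ, ∀ v : V, |(h : S → ℝ) v| ≤ M := fun h =>
    (hbdd h).imp fun M hM v => hM v v.2
  constructor
  · intro hφ
    obtain ⟨L, hLφ, hL⟩ := exists_extension_le_iSup
      ((LinearMap.funLeft ℝ ℝ ((↑) : V → S)).comp H.subtype) φ hbdd' fun h => by
        have hinf := hφ (-h)
        rw [sInf_image', map_neg] at hinf
        have hneg : -(⨆ v : V, (h : S → ℝ) v) ≤ ⨅ v : V, ((-h : H) : S → ℝ) v :=
          le_ciInf fun v => neg_le_neg (le_ciSup (bddAbove_range_of_abs_le (hbdd' h)) v)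
        exact neg_le_neg_iff.1 (hneg.trans hinf)
    refine ⟨Set.univ, _, faMeasure_of_linearMap L hL, trivial, ?_, fun h => ?_⟩
    · simp only [Set.indicator_univ]
      refine le_antisymm (hL _ _ ⟨1, by simp⟩ fun _ => le_rfl) ?_
      have h := hL (-fun _ => 1) (-1) ⟨1, by simp⟩ fun _ => le_rfl
      rw [map_neg] at h
      linarith
    · rw [← hLφ h]
      exact hasIntegral_of_bounded L hL (hbdd' h)
  · rintro ⟨𝒜, μ, hμ, huniv, hone, hint⟩ h
    refine (hint h).le_of_forall_le hμ huniv hone fun v => ?_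
    obtain ⟨M, hM⟩ := hbdd h
    refine csInf_le ⟨-M, ?_⟩ ⟨v, v.2, rfl⟩
    rintro _ ⟨w, hw, rfl⟩
    exact (abs_le.1 (hM w hw)).1
end

section
/- Let H be a vector lattice of real-valued functions and Ψ a set of positive linear functionals on H. A linear functional φ on H lies in the closed conical hull of Ψ (closure in the topology of pointwise convergence on H) if and only if φ(h) < 0 implies inf_{ψ ∈ Ψ} ψ(h) < 0 for every h ∈ H. -/
/-- The bipolar theorem for cones of linear functionals, in the topology of pointwise
convergence. -/
theorem PointedCone.coe_mem_closure_image_coe_iff {E : Type*} [AddCommGroup E] [Module ℝ E]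
    (K : PointedCone ℝ (E →ₗ[ℝ] ℝ)) (φ : E →ₗ[ℝ] ℝ) :
    (⇑φ : E → ℝ) ∈ closure ((fun ψ : E →ₗ[ℝ] ℝ => (⇑ψ : E → ℝ)) '' (K : Set (E →ₗ[ℝ] ℝ))) ↔
      ∀ x : E, (∀ ψ ∈ K, 0 ≤ ψ x) → 0 ≤ φ x := by
  constructor
  · intro hφ x hx
    have hclosed : IsClosed {f : E → ℝ | 0 ≤ f x} :=
      isClosed_le continuous_const (continuous_apply x)
    refine closure_minimal ?_ hclosed hφ
    rintro _ ⟨ψ, hψ, rfl⟩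
    exact hx ψ hψ
  · contrapose!
    intro hφ
    let B : (E →ₗ[ℝ] ℝ) →ₗ[ℝ] E →ₗ[ℝ] ℝ := LinearMap.id
    let L : PointedCone ℝ (WeakBilin B) := K
    let φ₀ : WeakBilin B := φ
    let C : ProperCone ℝ (WeakBilin B) := ⟨L.closure, isClosed_closure⟩
    have hind : Topology.IsInducing fun (ψ : WeakBilin B) x => B ψ x := ⟨rfl⟩
    have hC : φ₀ ∉ C := by
      intro h
      have h' : φ₀ ∈ closure (L : Set (WeakBilin B)) := h
      rw [hind.closure_eq_preimage_closure_image] at h'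
      exact hφ h'
    obtain ⟨f, hf, hfφ⟩ :=
      @ProperCone.hyperplane_separation_point (WeakBilin B) _ _ _ _ _ _ φ₀ C hC
    obtain ⟨x, rfl⟩ := LinearMap.dualEmbedding_surjective B f
    exact ⟨x, fun ψ hψ => hf ψ (subset_closure hψ), hfφ⟩

/-- An element is nonnegative on the conical hull of a set of functionals iff it is nonnegative
on the set. -/
theorem PointedCone.forall_mem_hull_apply_nonneg_iff {E : Type*} [AddCommGroup E] [Module ℝ E]
    {Ψ : Set (E →ₗ[ℝ] ℝ)} {x : E} :
    (∀ ψ ∈ PointedCone.hull ℝ Ψ, 0 ≤ ψ x) ↔ ∀ ψ ∈ Ψ, 0 ≤ ψ x := by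
  refine ⟨fun h ψ hψ => h ψ (PointedCone.subset_hull hψ), fun h ψ hψ => ?_⟩
  induction hψ using Submodule.span_induction with
  | mem ψ hψ => exact h ψ hψ
  | zero => simp
  | add ψ χ _ _ hψ hχ => exact add_nonneg hψ hχ
  | smul c ψ _ hψ => exact mul_nonneg c.2 hψ

/-- The conical hull is the additive submonoid generated by the nonnegative multiples. -/
theorem PointedCone.toAddSubmonoid_hull_eq_closure {M : Type*} [AddCommMonoid M] [Module ℝ M]
    (s : Set M) :
    (PointedCone.hull ℝ s).toAddSubmonoid =
      AddSubmonoid.closure {y : M | ∃ c : ℝ, 0 ≤ c ∧ ∃ x ∈ s, y = c • x} := by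
  refine (Submodule.span_eq_closure (R := {c : ℝ // 0 ≤ c})).trans (congrArg _ ?_)
  ext y
  constructor
  · rintro ⟨c, -, x, hx, rfl⟩
    exact ⟨c, c.2, x, hx, rfl⟩
  · rintro ⟨c, hc, x, hx, rfl⟩
    exact ⟨⟨c, hc⟩, Set.mem_univ _, x, hx, rfl⟩


/-- for a vector lattice `H` and a set `Ψ` of positive linear functionals,
`φ` belongs to the closed conical hull of `Ψ` (closure in the topology of pointwise
convergence on `H`) iff `φ` is `Ψ`-conglomerative: `φ(h) < 0` implies `ψ(h) < 0` for
some `ψ ∈ Ψ`. -/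
theorem stmt8 {H : Type*} [AddCommGroup H] [Lattice H] [Module ℝ H]
    (Ψ : Set (H →ₗ[ℝ] ℝ)) (hΨ : ∀ ψ ∈ Ψ, ∀ h : H, 0 ≤ h → 0 ≤ ψ h)
    (φ : H →ₗ[ℝ] ℝ) :
    (⇑φ : H → ℝ) ∈ closure ((fun ψ : H →ₗ[ℝ] ℝ => (⇑ψ : H → ℝ)) ''
        (AddSubmonoid.closure {χ : H →ₗ[ℝ] ℝ | ∃ c : ℝ, 0 ≤ c ∧ ∃ ψ ∈ Ψ, χ = c • ψ})) ↔
      ∀ h : H, φ h < 0 → ∃ ψ ∈ Ψ, ψ h < 0 := by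
  rw [← PointedCone.toAddSubmonoid_hull_eq_closure]
  refine (PointedCone.coe_mem_closure_image_coe_iff (PointedCone.hull ℝ Ψ) φ).trans ?_
  refine forall_congr' fun h => ?_
  rw [PointedCone.forall_mem_hull_apply_nonneg_iff, ← not_imp_not]
  push Not
  rfl
end
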